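/- Let P : ℝ^n → ℝ be convex and differentiable with ∇P Lipschitz continuous with constant h > 0. Decompose ℝ^n = ℝ^{n_1} × ⋯ × ℝ^{n_N}; for each i = 1,…,N let q_i : ℝ^{n_i} → (−∞, +∞] be proper, lower semicontinuous, and convex, let c_i > 0, and set Q(λ) = Σ_{i=1}^N q_i(λ_i) and Ψ = P + Q. Let D ∈ ℕ and τ : ℕ → ℕ satisfy 0 ≤ k − τ(k) ≤ D for all k. Let {λ(k)}_{k∈ℕ} be generated blockwise by λ_i(k+1) = prox^{c_i}_{q_i}[ λ_i(k) − c_i ∇_{λ_i} P(λ(τ(k))) ]. Then for every K ∈ ℕ, (K+1)·Ψ(λ(K+1)) − Σ_{k=0}^{K} Ψ(λ(k+1)) ≤ Σ_{k=0}^{K} Σ_{i=1}^N ( h(2k + D)(D+1)²/4 − k/c_i ) ‖λ_i(k+1) − λ_i(k)‖². -/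

import Mathlib

open scoped RealInnerProductSpace
open Finset

noncomputable section

/-- A proper extended-real-valued function: never `⊥` and not identically `⊤`. -/
def ProperE {E : Type*} (f : E → EReal) : Prop :=
  (∀ x, f x ≠ ⊥) ∧ (∃ x, f x ≠ ⊤)

/-- Convexity for extended-real-valued functions. -/
def ERealConvexOn {E : Type*} [AddCommGroup E] [Module ℝ E] (f : E → EReal) : Prop :=
  ∀ x y : E, ∀ a b : ℝ, 0 ≤ a → 0 ≤ b → a + b = 1 →
    f (a • x + b • y) ≤ (a : EReal) * f x + (b : EReal) * f y

/-- The block decomposition `ℝ^n = ℝ^{n_1} × ⋯ × ℝ^{n_N}` with the Euclidean norm. -/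
abbrev Blk {N : ℕ} (dims : Fin N → ℕ) :=
  PiLp 2 (fun i : Fin N => EuclideanSpace ℝ (Fin (dims i)))

section ConvexSmooth

variable {E : Type*} [NormedAddCommGroup E] [InnerProductSpace ℝ E] [CompleteSpace E]

/-- The derivative of a function with a gradient along a line. -/
theorem HasGradientAt.hasDerivAt_line {P : E → ℝ} {g : E → E}
    (hP : ∀ x, HasGradientAt P (g x) x) (x d : E) (t : ℝ) :
    HasDerivAt (fun s : ℝ => P (x + s • d)) ⟪g (x + t • d), d⟫ t := by
  have hline : HasDerivAt (fun s : ℝ => x + s • d) d t := by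
    simpa using ((hasDerivAt_id t).smul_const d).const_add x
  have := (hP (x + t • d)).hasFDerivAt.comp_hasDerivAt t hline
  simpa [Function.comp_def] using this

/-- The descent lemma: a function with Lipschitz gradient lies below its quadratic model. -/
theorem le_add_inner_add_of_lipschitz_gradient {P : E → ℝ} {g : E → E} {h : ℝ}
    (hP : ∀ x, HasGradientAt P (g x) x) (hLip : ∀ u v, ‖g u - g v‖ ≤ h * ‖u - v‖) (x y : E) :
    P y ≤ P x + ⟪g x, y - x⟫ + h / 2 * ‖y - x‖ ^ 2 := by
  set d := y - x with hd
  let φ : ℝ → ℝ := fun t => P (x + t • d) - t * ⟪g x, d⟫ - t ^ 2 * (h / 2 * ‖d‖ ^ 2)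
  have hφ (t : ℝ) : HasDerivAt φ
      (⟪g (x + t • d), d⟫ - ⟪g x, d⟫ - 2 * t * (h / 2 * ‖d‖ ^ 2)) t := by
    have h1 := (hasDerivAt_id t).mul_const ⟪g x, d⟫
    have h2 := (hasDerivAt_pow 2 t).mul_const (h / 2 * ‖d‖ ^ 2)
    refine (((HasGradientAt.hasDerivAt_line hP x d t).sub h1).sub h2).congr_deriv ?_
    simp
  have hanti : AntitoneOn φ (Set.Icc 0 1) := by
    refine antitoneOn_of_deriv_nonpos (convex_Icc 0 1)
      (fun t _ => (hφ t).continuousAt.continuousWithinAt)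
      (fun t _ => (hφ t).differentiableAt.differentiableWithinAt) fun t ht => ?_
    rw [interior_Icc] at ht
    rw [(hφ t).deriv, ← inner_sub_left]
    have hl := hLip (x + t • d) x
    rw [add_sub_cancel_left, norm_smul, Real.norm_of_nonneg ht.1.le] at hl
    have := (real_inner_le_norm (g (x + t • d) - g x) d).trans
      (mul_le_mul_of_nonneg_right hl (norm_nonneg d))
    linarith
  have h01 := hanti (Set.left_mem_Icc.2 zero_le_one) (Set.right_mem_Icc.2 zero_le_one) zero_le_one
  simp only [φ, zero_smul, add_zero, one_smul, zero_mul, one_mul, hd, add_sub_cancel] at h01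
  simp only [hd]
  linarith

/-- A convex function lies above its linearizations. -/
theorem ConvexOn.add_inner_gradient_le {P : E → ℝ} {g : E → E}
    (hconv : ConvexOn ℝ Set.univ P) (hP : ∀ x, HasGradientAt P (g x) x) (x y : E) :
    P x + ⟪g x, y - x⟫ ≤ P y := by
  have hc : ConvexOn ℝ Set.univ (fun s : ℝ => P (x + s • (y - x))) := by
    have := hconv.comp_affineMap (AffineMap.lineMap x y : ℝ →ᵃ[ℝ] E)
    rw [Set.preimage_univ] at this
    refine this.congr fun s _ => ?_
    simp [AffineMap.lineMap_apply, add_comm]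
  have hs := hc.le_slope_of_hasDerivAt (Set.mem_univ 0) (Set.mem_univ 1) zero_lt_one
    (HasGradientAt.hasDerivAt_line hP x (y - x) 0)
  simp [slope_def_field] at hs
  linarith

/-- The increment of a convex function with Lipschitz gradient, bounded with the gradient taken
at a third point. -/
theorem ConvexOn.sub_le_inner_gradient_add {P : E → ℝ} {g : E → E} {h : ℝ}
    (hconv : ConvexOn ℝ Set.univ P) (hP : ∀ x, HasGradientAt P (g x) x)
    (hLip : ∀ u v, ‖g u - g v‖ ≤ h * ‖u - v‖) (x y z : E) :
    P y - P x ≤ ⟪g z, y - x⟫ + h / 2 * ‖y - z‖ ^ 2 := by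
  have h1 := le_add_inner_add_of_lipschitz_gradient hP hLip z y
  have h2 := hconv.add_inner_gradient_le hP z x
  have h3 : ⟪g z, y - x⟫ = ⟪g z, y - z⟫ - ⟪g z, x - z⟫ := by
    rw [← inner_sub_right, sub_sub_sub_cancel_right]
  linarith

end ConvexSmooth

section Prox

variable {E : Type*} [NormedAddCommGroup E]

/-- Minimizers of a proximal objective have finite value. -/
theorem ne_top_of_forall_prox_le {q : E → EReal} (hq : ProperE q) {c : ℝ} {a w : E}
    (hmin : ∀ v, q a + ((1 / (2 * c) * ‖a - w‖ ^ 2 : ℝ) : EReal)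
      ≤ q v + ((1 / (2 * c) * ‖v - w‖ ^ 2 : ℝ) : EReal)) : q a ≠ ⊤ := by
  intro ha
  obtain ⟨v, hv⟩ := hq.2
  have := hmin v
  rw [ha, EReal.top_add_coe, ← EReal.coe_toReal hv (hq.1 v), ← EReal.coe_add] at this
  exact EReal.coe_ne_top _ (top_le_iff.1 this)

/-- Strong form of the optimality condition for a proximal gradient step, comparing the new
point with the old one. -/
theorem sub_le_of_forall_prox_le [InnerProductSpace ℝ E] {q : E → EReal} (hq : ProperE q)
    (hconv : ERealConvexOn q) {c : ℝ} (hc : 0 < c) {a b g : E}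
    (hmin : ∀ v, q a + ((1 / (2 * c) * ‖a - (b - c • g)‖ ^ 2 : ℝ) : EReal)
      ≤ q v + ((1 / (2 * c) * ‖v - (b - c • g)‖ ^ 2 : ℝ) : EReal)) (hb : q b ≠ ⊤) :
    (q a).toReal - (q b).toReal ≤ -⟪g, a - b⟫ - 1 / c * ‖a - b‖ ^ 2 := by
  have ha := ne_top_of_forall_prox_le hq hmin
  have key (t : ℝ) (ht0 : 0 < t) (ht1 : t ≤ 1) :
      (q a).toReal - (q b).toReal
        ≤ (-⟪g, a - b⟫ - 1 / c * ‖a - b‖ ^ 2) + t * (1 / (2 * c) * ‖a - b‖ ^ 2) := by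
    have h1 := (hmin ((1 - t) • a + t • b)).trans (add_le_add_left
      (hconv a b (1 - t) t (by linarith) ht0.le (by ring)) _)
    rw [← EReal.coe_toReal ha (hq.1 a), ← EReal.coe_toReal hb (hq.1 b)] at h1
    norm_cast at h1
    have h2 : (1 - t) • a + t • b - (b - c • g) = (a - (b - c • g)) - t • (a - b) := by module
    have h3 : ⟪a - (b - c • g), a - b⟫ = ‖a - b‖ ^ 2 + c * ⟪g, a - b⟫ := by
      rw [show a - (b - c • g) = (a - b) + c • g by module, inner_add_left,
        real_inner_self_eq_norm_sq, real_inner_smul_left]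
    rw [h2, norm_sub_sq_real (a - (b - c • g)), real_inner_smul_right, h3, norm_smul, mul_pow,
      Real.norm_of_nonneg ht0.le] at h1
    refine le_of_mul_le_mul_left ?_ ht0
    have h4 : 1 / (2 * c) * (‖a - (b - c • g)‖ ^ 2
        - 2 * (t * (‖a - b‖ ^ 2 + c * ⟪g, a - b⟫)) + t ^ 2 * ‖a - b‖ ^ 2)
        = 1 / (2 * c) * ‖a - (b - c • g)‖ ^ 2
          + t * (-⟪g, a - b⟫ - 1 / c * ‖a - b‖ ^ 2 + t * (1 / (2 * c) * ‖a - b‖ ^ 2)) := by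
      field_simp
      ring
    rw [h4] at h1
    linarith
  refine le_of_forall_pos_le_add fun ε hε => ?_
  set M := 1 / (2 * c) * ‖a - b‖ ^ 2
  have hM : 0 ≤ M := by positivity
  have ht : 0 < min 1 (ε / (M + 1)) := by positivity
  refine (key _ ht (min_le_left _ _)).trans (add_le_add_right ?_ _)
  calc min 1 (ε / (M + 1)) * M ≤ ε / (M + 1) * (M + 1) := by
        gcongr
        · exact min_le_right _ _
        · linarith
    _ = ε := by field_simp

end Prox

section Sums

theorem EReal.coe_finset_sum {ι : Type*} (t : Finset ι) (f : ι → ℝ) :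
    ((∑ i ∈ t, f i : ℝ) : EReal) = ∑ i ∈ t, (f i : EReal) :=
  map_sum (⟨⟨Real.toEReal, EReal.coe_zero⟩, EReal.coe_add⟩ : ℝ →+ EReal) f t

/-- The square of a displacement over at most `D + 1` steps. -/
theorem norm_sub_sq_le_sum_Ico {E : Type*} [NormedAddCommGroup E] (x : ℕ → E) {D m k : ℕ}
    (hmk : m ≤ k) (hD : k ≤ m + D) :
    ‖x k - x m‖ ^ 2 ≤ D * ∑ j ∈ Ico m k, ‖x (j + 1) - x j‖ ^ 2 := by
  have h1 : ‖x k - x m‖ ≤ ∑ j ∈ Ico m k, ‖x (j + 1) - x j‖ := by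
    simpa only [dist_eq_norm, norm_sub_rev] using dist_le_Ico_sum_dist x hmk
  have h2 : ((#(Ico m k) : ℕ) : ℝ) ≤ D := by
    rw [Nat.card_Ico]
    exact_mod_cast (by omega : k - m ≤ D)
  calc ‖x k - x m‖ ^ 2 ≤ (∑ j ∈ Ico m k, ‖x (j + 1) - x j‖) ^ 2 := by gcongr
    _ ≤ #(Ico m k) * ∑ j ∈ Ico m k, ‖x (j + 1) - x j‖ ^ 2 := sq_sum_le_card_mul_sum_sq
    _ ≤ D * ∑ j ∈ Ico m k, ‖x (j + 1) - x j‖ ^ 2 := by gcongr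

theorem sum_Icc_add_cast (j D : ℕ) :
    ∑ k ∈ Icc j (j + D), (k : ℝ) = (D + 1) * (2 * j + D) / 2 := by
  induction D with
  | zero => simp
  | succ D ih =>
    rw [← add_assoc, Finset.sum_Icc_succ_top (by omega), ih]
    push_cast
    ring

/-- Exchanging the order of summation in a weighted sum over sliding windows. -/
theorem sum_mul_sum_window_le {s : ℕ → ℝ} (hs : ∀ j, 0 ≤ s j) (τ : ℕ → ℕ) {D : ℕ}
    (hτ : ∀ k, k ≤ τ k + D) (n : ℕ) :
    ∑ k ∈ range n, (k : ℝ) * ∑ j ∈ Ico (τ k) (k + 1), s j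
      ≤ ∑ j ∈ range n, (D + 1) * (2 * j + D) / 2 * s j := by
  have h1 : ∀ k ∈ range n, (k : ℝ) * ∑ j ∈ Ico (τ k) (k + 1), s j
      ≤ ∑ j ∈ range n, if k ∈ Icc j (j + D) then (k : ℝ) * s j else 0 := by
    intro k hk
    rw [mul_sum, ← sum_filter]
    refine sum_le_sum_of_subset_of_nonneg (fun j hj => ?_)
      fun j _ _ => mul_nonneg k.cast_nonneg (hs j)
    have := hτ k
    simp only [mem_Ico, mem_filter, mem_range, mem_Icc] at hj hk ⊢
    omega
  refine (sum_le_sum h1).trans ?_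
  rw [sum_comm]
  refine sum_le_sum fun j _ => ?_
  rw [← sum_filter, ← sum_Icc_add_cast, sum_mul]
  refine sum_le_sum_of_subset_of_nonneg (fun k hk => (mem_filter.1 hk).2)
    fun k _ _ => mul_nonneg k.cast_nonneg (hs j)

theorem add_one_mul_sub_sum_range (a : ℕ → ℝ) (K : ℕ) :
    ((K : ℝ) + 1) * a (K + 1) - ∑ k ∈ range (K + 1), a (k + 1)
      = ∑ k ∈ range (K + 1), (k : ℝ) * (a (k + 1) - a k) := by
  induction K with
  | zero => simp
  | succ K ih =>
    rw [sum_range_succ, sum_range_succ _ (K + 1), ← ih]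
    push_cast
    ring

end Sums


/-- weighted inequality for the asynchronous blockwise proximal gradient
iteration, with `Ψ = P + Σᵢ qᵢ`:
`(K+1)·Ψ(λ(K+1)) − Σ_{k=0}^{K} Ψ(λ(k+1))
  ≤ Σ_{k=0}^{K} Σᵢ (h(2k+D)(D+1)²/4 − k/cᵢ)‖λᵢ(k+1) − λᵢ(k)‖²`. -/
theorem stmt13 {N : ℕ} (dims : Fin N → ℕ) (h : ℝ) (hh : 0 < h)
    (P : Blk dims → ℝ) (gradP : Blk dims → Blk dims)
    (hPconv : ConvexOn ℝ Set.univ P)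
    (hPdiff : ∀ x, HasGradientAt P (gradP x) x)
    (hLip : ∀ u v : Blk dims, ‖gradP u - gradP v‖ ≤ h * ‖u - v‖)
    (q : ∀ i : Fin N, EuclideanSpace ℝ (Fin (dims i)) → EReal)
    (hqproper : ∀ i, ProperE (q i)) (hqlsc : ∀ i, LowerSemicontinuous (q i))
    (hqconv : ∀ i, ERealConvexOn (q i))
    (c : Fin N → ℝ) (hc : ∀ i, 0 < c i)
    (D : ℕ) (τ : ℕ → ℕ) (hτ : ∀ k : ℕ, τ k ≤ k ∧ k - τ k ≤ D)
    (lam : ℕ → Blk dims)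
    (hiter : ∀ (k : ℕ) (i : Fin N), ∀ v : EuclideanSpace ℝ (Fin (dims i)),
      q i (lam (k + 1) i) +
          ((1 / (2 * c i) *
            ‖lam (k + 1) i - (lam k i - c i • gradP (lam (τ k)) i)‖ ^ 2 : ℝ) : EReal)
        ≤ q i v +
          ((1 / (2 * c i) * ‖v - (lam k i - c i • gradP (lam (τ k)) i)‖ ^ 2 : ℝ) : EReal)) :
    ∀ K : ℕ,
      (((K : ℝ) + 1 : ℝ) : EReal) *
            ((P (lam (K + 1)) : EReal) + ∑ i : Fin N, q i (lam (K + 1) i)) -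
          ∑ k ∈ Finset.range (K + 1),
            ((P (lam (k + 1)) : EReal) + ∑ i : Fin N, q i (lam (k + 1) i))
        ≤ ((∑ k ∈ Finset.range (K + 1), ∑ i : Fin N,
              (h * (2 * (k : ℝ) + D) * ((D : ℝ) + 1) ^ 2 / 4 - (k : ℝ) / c i) *
                ‖lam (k + 1) i - lam k i‖ ^ 2 : ℝ) : EReal) := by
  intro K
  have hfin (k : ℕ) (i : Fin N) : q i (lam (k + 1) i) ≠ ⊤ :=
    ne_top_of_forall_prox_le (hqproper i) (hiter k i)
  set ψ : ℕ → ℝ := fun k => P (lam k) + ∑ i, (q i (lam k i)).toReal with hψ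
  set s : ℕ → ℝ := fun k => ‖lam (k + 1) - lam k‖ ^ 2 with hs
  have hcoe (k : ℕ) : (P (lam (k + 1)) : EReal) + ∑ i, q i (lam (k + 1) i)
      = (ψ (k + 1) : EReal) := by
    rw [hψ, EReal.coe_add, EReal.coe_finset_sum]
    congr 1
    exact sum_congr rfl fun i _ => (EReal.coe_toReal (hfin k i) ((hqproper i).1 _)).symm
  have hsblk (k : ℕ) : s k = ∑ i, ‖lam (k + 1) i - lam k i‖ ^ 2 := by
    simp only [hs, PiLp.norm_sq_eq_of_L2, PiLp.sub_apply]
  have hstep (k : ℕ) (hk : 1 ≤ k) : ψ (k + 1) - ψ k ≤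
      h / 2 * ((D + 1) * ∑ j ∈ Ico (τ k) (k + 1), s j)
        - ∑ i, 1 / c i * ‖lam (k + 1) i - lam k i‖ ^ 2 := by
    have hP := hPconv.sub_le_inner_gradient_add hPdiff hLip (lam k) (lam (k + 1)) (lam (τ k))
    have hw := norm_sub_sq_le_sum_Ico lam (D := D + 1) (m := τ k) (k := k + 1)
      (by have := hτ k; omega) (by have := hτ k; omega)
    have hq : ∑ i, ((q i (lam (k + 1) i)).toReal - (q i (lam k i)).toReal) ≤
        ∑ i, (-⟪gradP (lam (τ k)) i, lam (k + 1) i - lam k i⟫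
          - 1 / c i * ‖lam (k + 1) i - lam k i‖ ^ 2) := by
      refine sum_le_sum fun i _ => sub_le_of_forall_prox_le (hqproper i) (hqconv i) (hc i)
        (hiter k i) ?_
      obtain ⟨m, rfl⟩ := Nat.exists_eq_add_of_le' hk
      exact hfin m i
    have hw' := mul_le_mul_of_nonneg_left hw (half_pos hh).le
    rw [PiLp.inner_apply] at hP
    simp only [sum_sub_distrib, sum_neg_distrib] at hq
    simp only [PiLp.sub_apply] at hP
    push_cast at hw'
    simp only [hψ, hs]
    linarith
  have hmain : ((K : ℝ) + 1) * ψ (K + 1) - ∑ k ∈ range (K + 1), ψ (k + 1) ≤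
      ∑ k ∈ range (K + 1), ∑ i : Fin N,
        (h * (2 * (k : ℝ) + D) * ((D : ℝ) + 1) ^ 2 / 4 - (k : ℝ) / c i) *
          ‖lam (k + 1) i - lam k i‖ ^ 2 := by
    have hwin := sum_mul_sum_window_le (s := s) (fun j => by positivity) τ (D := D)
      (fun k => by have := hτ k; omega) (K + 1)
    calc _ = ∑ k ∈ range (K + 1), (k : ℝ) * (ψ (k + 1) - ψ k) := add_one_mul_sub_sum_range ψ K
      _ ≤ ∑ k ∈ range (K + 1), (k : ℝ) * (h / 2 * ((D + 1) * ∑ j ∈ Ico (τ k) (k + 1), s j)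
            - ∑ i, 1 / c i * ‖lam (k + 1) i - lam k i‖ ^ 2) := by
          refine sum_le_sum fun k _ => ?_
          rcases Nat.eq_zero_or_pos k with rfl | hk
          · simp
          · exact mul_le_mul_of_nonneg_left (hstep k hk) k.cast_nonneg
      _ = h / 2 * (D + 1) * ∑ k ∈ range (K + 1), (k : ℝ) * ∑ j ∈ Ico (τ k) (k + 1), s j
            - ∑ k ∈ range (K + 1), (k : ℝ) * ∑ i, 1 / c i * ‖lam (k + 1) i - lam k i‖ ^ 2 := by
          rw [mul_sum, ← sum_sub_distrib]
          exact sum_congr rfl fun k _ => by ring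
      _ ≤ h / 2 * (D + 1) * ∑ j ∈ range (K + 1), (D + 1) * (2 * j + D) / 2 * s j
            - ∑ k ∈ range (K + 1), (k : ℝ) * ∑ i, 1 / c i * ‖lam (k + 1) i - lam k i‖ ^ 2 := by
          gcongr
      _ = _ := by
          rw [mul_sum, ← sum_sub_distrib]
          refine sum_congr rfl fun k _ => ?_
          simp only [hsblk, mul_sum, ← sum_sub_distrib]
          exact sum_congr rfl fun i _ => by ring
  simp only [hcoe]
  rw [← EReal.coe_finset_sum, ← EReal.coe_mul, ← EReal.coe_sub]
  exact EReal.coe_le_coe_iff.2 hmain
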